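/- arXiv:2008.06088 — 3 statements merged into one kernel-verified Lean document; each statement's English description precedes it below -/
import Mathlib

section
/- Let r > 0, θ ∈ ℝ, σ > 0. Then for every M > 0 there exist a function h : ℝ → ℝ that is Lipschitz with constant 1, a point x > 0, functions g₁, g₂ : ℝ → ℝ, and d ∈ ℝ, such that the solution f_h of the VG(r,θ,σ,0) Stein equation with test function h has derivative g₁(y) at every y > 0 in some neighborhood of x, g₁ has derivative g₂(y) at every y > 0 in some neighborhood of x, g₂ has derivative d at x, and |d| > M. In other words, there is no constant M(r,θ,σ) such that the third derivative of the Stein solution is uniformly bounded by M(r,θ,σ) times the Lipschitz constant of the test function, over all Lipschitz test functions. -/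
open MeasureTheory Real Filter

/-- Modified Bessel function of the second kind. -/
noncomputable def besselK (ν x : ℝ) : ℝ :=
  ∫ t in Set.Ioi (0:ℝ), Real.exp (-x * Real.cosh t) * Real.cosh (ν * t)

/-- Modified Bessel function of the first kind. -/
noncomputable def besselI (ν x : ℝ) : ℝ :=
  ∑' k : ℕ, (x / 2) ^ (ν + 2 * (k : ℝ)) / (Real.Gamma (ν + (k : ℝ) + 1) * (Nat.factorial k))

/-- The VG(r,θ,σ,0) density. -/
noncomputable def vgDensity (r θ σ x : ℝ) : ℝ :=
  (σ * Real.sqrt Real.pi * Real.Gamma (r / 2))⁻¹ * Real.exp (θ * x / σ ^ 2) *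
    (|x| / (2 * Real.sqrt (θ ^ 2 + σ ^ 2))) ^ ((r - 1) / 2) *
    besselK ((r - 1) / 2) (Real.sqrt (θ ^ 2 + σ ^ 2) * |x| / σ ^ 2)

/-- The centred test function h̃(x) = h(x) − E h(Z). -/
noncomputable def htilde (r θ σ : ℝ) (h : ℝ → ℝ) (x : ℝ) : ℝ :=
  h x - ∫ t, h t * vgDensity r θ σ t

/-- The solution of the VG(r,θ,σ,0) Stein equation with test function h. -/
noncomputable def steinSolution (r θ σ : ℝ) (h : ℝ → ℝ) (x : ℝ) : ℝ :=
  -(Real.exp (-(θ / σ ^ 2) * x) *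
      besselK ((r - 1) / 2) (Real.sqrt (θ ^ 2 + σ ^ 2) / σ ^ 2 * |x|) /
      (σ ^ 2 * |x| ^ ((r - 1) / 2))) *
    (∫ t in (0:ℝ)..x, Real.exp ((θ / σ ^ 2) * t) * |t| ^ ((r - 1) / 2) *
      besselI ((r - 1) / 2) (Real.sqrt (θ ^ 2 + σ ^ 2) / σ ^ 2 * |t|) * htilde r θ σ h t) -
  (Real.exp (-(θ / σ ^ 2) * x) *
      besselI ((r - 1) / 2) (Real.sqrt (θ ^ 2 + σ ^ 2) / σ ^ 2 * |x|) /
      (σ ^ 2 * |x| ^ ((r - 1) / 2))) *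
    (∫ t in Set.Ioi x, Real.exp ((θ / σ ^ 2) * t) * |t| ^ ((r - 1) / 2) *
      besselK ((r - 1) / 2) (Real.sqrt (θ ^ 2 + σ ^ 2) / σ ^ 2 * |t|) * htilde r θ σ h t)

/-- The constant A(r,θ,σ). -/
noncomputable def Aconst (r θ σ : ℝ) : ℝ :=
  if 2 ≤ r then 2 * Real.sqrt Real.pi / Real.sqrt (2 * r - 1) * (1 + θ ^ 2 / σ ^ 2) ^ (r / 2)
  else 12 * Real.Gamma (r / 2) * (1 + θ ^ 2 / σ ^ 2)

/-- The constant B(r,θ,σ). -/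
noncomputable def Bconst (r θ σ : ℝ) : ℝ :=
  if 2 ≤ r then Real.sqrt (Real.pi * (r - 1) / 2) * (1 + θ ^ 2 / σ ^ 2) ^ (r / 2 - 1)
  else 2

/-- The constant C(r,θ,σ). -/
noncomputable def Cconst (r θ σ : ℝ) : ℝ :=
  6 + 2 * Real.sqrt 2 / Real.sqrt r +
    2 * Real.sqrt (2 * Real.pi * (r + 1)) * (|θ| / σ) * (1 + θ ^ 2 / σ ^ 2) ^ ((r - 1) / 2) +
    2 * (Real.sqrt (2 * r) + r) * Aconst r θ σ


/-- Moments of the kernel of the Bessel function of the second kind. -/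
noncomputable def bK (ν : ℝ) (n : ℕ) (x : ℝ) : ℝ :=
  ∫ t in Set.Ioi (0:ℝ), Real.cosh t ^ n * (Real.exp (-x * Real.cosh t) * Real.cosh (ν * t))

lemma cosh_le_exp_abs (t : ℝ) : Real.cosh t ≤ Real.exp |t| := by
  rw [← Real.cosh_abs, Real.cosh_eq]
  have : Real.exp (-|t|) ≤ Real.exp |t| := Real.exp_le_exp.2 (by linarith [abs_nonneg t])
  linarith

lemma exp_double_tendsto (N x : ℝ) (hx : 0 < x) :
    Tendsto (fun t : ℝ => Real.exp (N * t) * Real.exp (-(x / 2) * Real.exp t)) atTop (nhds 0) := by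
  have h := (tendsto_rpow_mul_exp_neg_mul_atTop_nhds_zero N (x/2) (by positivity)).comp
    Real.tendsto_exp_atTop
  refine h.congr fun t => ?_
  simp only [Function.comp]
  rw [← Real.exp_mul, mul_comm N t]

lemma kernel_bound (ν x : ℝ) (hx : 0 < x) (n : ℕ) (t : ℝ) (ht : 0 ≤ t) :
    Real.cosh t ^ n * (Real.exp (-x * Real.cosh t) * Real.cosh (ν * t)) ≤
      Real.exp ((n + |ν|) * t) * Real.exp (-(x / 2) * Real.exp t) := by
  have h1 : Real.cosh t ≤ Real.exp t := by simpa [abs_of_nonneg ht] using cosh_le_exp_abs t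
  have h2 : Real.cosh (ν * t) ≤ Real.exp (|ν| * t) := by
    simpa [abs_mul, abs_of_nonneg ht] using cosh_le_exp_abs (ν * t)
  have h3 : Real.exp t / 2 ≤ Real.cosh t := by
    rw [Real.cosh_eq]; linarith [Real.exp_pos (-t)]
  have h4 : Real.exp (-x * Real.cosh t) ≤ Real.exp (-(x / 2) * Real.exp t) := by
    apply Real.exp_le_exp.2; nlinarith
  have h5 : Real.cosh t ^ n ≤ Real.exp (n * t) := by
    rw [Real.exp_nat_mul]
    exact pow_le_pow_left₀ (Real.cosh_pos t).le h1 n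
  calc _ ≤ Real.exp (n * t) * (Real.exp (-(x / 2) * Real.exp t) * Real.exp (|ν| * t)) := by
        have := (Real.cosh_pos (ν * t)).le
        gcongr
    _ = _ := by rw [add_mul, Real.exp_add]; ring

lemma kernel_integrable (ν x : ℝ) (hx : 0 < x) (n : ℕ) :
    IntegrableOn (fun t : ℝ => Real.cosh t ^ n * (Real.exp (-x * Real.cosh t) * Real.cosh (ν * t)))
      (Set.Ioi 0) := by
  apply integrable_of_isBigO_exp_neg (b := 1) one_pos
  · fun_prop
  · have h := exp_double_tendsto ((n + |ν|) + 1) x hx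
    have h' : ∀ᶠ t : ℝ in atTop, Real.exp (((n + |ν|) + 1) * t) * Real.exp (-(x / 2) * Real.exp t) ≤ 1 :=
      h.eventually_le_const one_pos
    apply Asymptotics.IsBigO.of_bound 1
    filter_upwards [h', eventually_ge_atTop 0] with t ht ht0
    have hb := kernel_bound ν x hx n t ht0
    have hpos : 0 ≤ Real.cosh t ^ n * (Real.exp (-x * Real.cosh t) * Real.cosh (ν * t)) := by
      have := (Real.cosh_pos (ν * t)).le
      have := (Real.cosh_pos (t)).le
      positivity
    rw [Real.norm_of_nonneg hpos, Real.norm_of_nonneg (Real.exp_pos _).le, one_mul]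
    refine hb.trans ?_
    rw [add_mul, Real.exp_add, one_mul] at ht
    have : Real.exp (-1 * t) * Real.exp t = 1 := by rw [← Real.exp_add]; simp
    nlinarith [Real.exp_pos (-1*t), Real.exp_pos t]

lemma bK_hasDerivAt (ν x : ℝ) (hx : 0 < x) (n : ℕ) :
    HasDerivAt (bK ν n) (-bK ν (n+1) x) x := by
  have := hasDerivAt_integral_of_dominated_loc_of_deriv_le
    (μ := volume.restrict (Set.Ioi (0:ℝ))) (x₀ := x) (s := Set.Ioi (x/2))
    (F := fun x t => Real.cosh t ^ n * (Real.exp (-x * Real.cosh t) * Real.cosh (ν * t)))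
    (F' := fun x t => -(Real.cosh t ^ (n+1) * (Real.exp (-x * Real.cosh t) * Real.cosh (ν * t))))
    (bound := fun t => Real.cosh t ^ (n+1) * (Real.exp (-(x/2) * Real.cosh t) * Real.cosh (ν * t)))
    (Ioi_mem_nhds (by linarith)) ?_ (kernel_integrable ν x hx n) ?_ ?_
    (kernel_integrable ν (x/2) (by positivity) (n+1)) ?_
  · have h2 := this.2
    rw [integral_neg] at h2
    exact h2
  · refine Eventually.of_forall fun y => Continuous.aestronglyMeasurable (by fun_prop)
  · exact Continuous.aestronglyMeasurable (by fun_prop)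
  · refine Eventually.of_forall fun t y hy => ?_
    have := (Real.cosh_pos (ν * t))
    have h1 := (Real.cosh_pos (t))
    rw [norm_neg, Real.norm_of_nonneg (by positivity)]
    have : -y * Real.cosh t ≤ -(x/2) * Real.cosh t := by
      have : x/2 < y := hy
      nlinarith
    gcongr
  · refine Eventually.of_forall fun t y hy => ?_
    have h1 : HasDerivAt (fun y : ℝ => -y * Real.cosh t) (-1 * Real.cosh t) y :=
      ((hasDerivAt_id y).neg).mul_const _
    have := ((h1.exp).mul_const (Real.cosh (ν * t))).const_mul (Real.cosh t ^ n)
    refine this.congr_deriv ?_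
    ring

lemma bK_zero (ν : ℝ) : besselK ν = bK ν 0 := by
  funext x; simp [besselK, bK]

lemma bK_pos (ν x : ℝ) (hx : 0 < x) (n : ℕ) : 0 < bK ν n x := by
  unfold bK
  have hp : ∀ t : ℝ, 0 < Real.cosh t ^ n * (Real.exp (-x * Real.cosh t) * Real.cosh (ν * t)) := by
    intro t
    have := (Real.cosh_pos (ν * t))
    have h1 := (Real.cosh_pos (t))
    positivity
  rw [setIntegral_pos_iff_support_of_nonneg_ae (Eventually.of_forall fun t => (hp t).le)
    (kernel_integrable ν x hx n)]
  have : Function.support (fun t : ℝ => Real.cosh t ^ n * (Real.exp (-x * Real.cosh t) * Real.cosh (ν * t))) = Set.univ := by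
    ext t; simpa using (hp t).ne'
  rw [this]; simp

lemma bK_ode (ν x : ℝ) (hx : 0 < x) :
    x ^ 2 * bK ν 2 x - x * bK ν 1 x - (x ^ 2 + ν ^ 2) * bK ν 0 x = 0 := by
  have i0 := kernel_integrable ν x hx 0
  have i1 := kernel_integrable ν x hx 1
  have i2 := kernel_integrable ν x hx 2
  have key := integral_Ioi_of_hasDerivAt_of_tendsto (a := 0) (m := 0)
    (f := fun t : ℝ => -x * Real.sinh t * Real.exp (-x * Real.cosh t) * Real.cosh (ν * t)
      - ν * Real.exp (-x * Real.cosh t) * Real.sinh (ν * t))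
    (f' := fun t : ℝ => x ^ 2 * (Real.cosh t ^ 2 * (Real.exp (-x * Real.cosh t) * Real.cosh (ν * t)))
      - x * (Real.cosh t ^ 1 * (Real.exp (-x * Real.cosh t) * Real.cosh (ν * t)))
      - (x ^ 2 + ν ^ 2) * (Real.cosh t ^ 0 * (Real.exp (-x * Real.cosh t) * Real.cosh (ν * t))))
    (by fun_prop) ?_ ?_ ?_
  · have i21 : IntegrableOn (fun t : ℝ =>
        x ^ 2 * (Real.cosh t ^ 2 * (Real.exp (-x * Real.cosh t) * Real.cosh (ν * t)))
        - x * (Real.cosh t ^ 1 * (Real.exp (-x * Real.cosh t) * Real.cosh (ν * t)))) (Set.Ioi 0) :=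
      (i2.const_mul _).sub (i1.const_mul _)
    rw [integral_sub i21 (i0.const_mul _),
      integral_sub (i2.const_mul _) (i1.const_mul _), integral_const_mul, integral_const_mul,
      integral_const_mul] at key
    simpa [bK] using key
  · intro t _
    have hE : HasDerivAt (fun t : ℝ => Real.exp (-x * Real.cosh t))
      (Real.exp (-x * Real.cosh t) * (-x * Real.sinh t)) t :=
      ((Real.hasDerivAt_cosh t).const_mul (-x)).exp
    have hl : HasDerivAt (fun t : ℝ => ν * t) ν t := by
      simpa using (hasDerivAt_id t).const_mul ν
    have hC := hl.cosh
    have hS := hl.sinh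
    have h := ((((Real.hasDerivAt_sinh t).const_mul (-x)).mul hE).mul hC).sub
      ((hE.const_mul ν).mul hS)
    refine h.congr_deriv ?_
    have := Real.cosh_sq t
    simp only [Pi.mul_apply]
    have e : Real.sinh t ^ 2 = Real.cosh t ^ 2 - 1 := by linarith
    ring_nf
    rw [e]; ring
  · exact ((i2.const_mul _).sub (i1.const_mul _)).sub (i0.const_mul _)
  · have hb : ∀ᶠ t : ℝ in atTop, ‖-x * Real.sinh t * Real.exp (-x * Real.cosh t) * Real.cosh (ν * t)
      - ν * Real.exp (-x * Real.cosh t) * Real.sinh (ν * t)‖ ≤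
        x * (Real.exp (((1:ℕ) + |ν|) * t) * Real.exp (-(x / 2) * Real.exp t)) +
        |ν| * (Real.exp (((0:ℕ) + |ν|) * t) * Real.exp (-(x / 2) * Real.exp t)) := by
      filter_upwards [eventually_ge_atTop 0] with t ht
      have k1 := kernel_bound ν x hx 1 t ht
      have k0 := kernel_bound ν x hx 0 t ht
      have hs : ∀ s : ℝ, |Real.sinh s| ≤ Real.cosh s := by
        intro s
        rw [abs_le, Real.sinh_eq, Real.cosh_eq]
        constructor <;> linarith [Real.exp_pos s, Real.exp_pos (-s)]
      refine (norm_sub_le _ _).trans (add_le_add ?_ ?_)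
      · refine le_trans ?_ (mul_le_mul_of_nonneg_left k1 hx.le)
        rw [Real.norm_eq_abs, abs_mul, abs_mul, abs_mul, abs_neg, abs_of_pos hx, Real.abs_exp,
          abs_of_pos (Real.cosh_pos _)]
        have := hs t
        have := (Real.cosh_pos (ν * t)).le
        calc _ ≤ x * Real.cosh t * Real.exp (-x * Real.cosh t) * Real.cosh (ν * t) := by gcongr
          _ = _ := by ring
      · refine le_trans ?_ (mul_le_mul_of_nonneg_left k0 (abs_nonneg ν))
        rw [Real.norm_eq_abs, abs_mul, abs_mul, Real.abs_exp]
        have := hs (ν * t)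
        calc _ ≤ |ν| * Real.exp (-x * Real.cosh t) * Real.cosh (ν * t) := by gcongr
          _ = _ := by ring
    apply squeeze_zero_norm' hb
    have a1 := (exp_double_tendsto ((1:ℕ) + |ν|) x hx).const_mul x
    have a0 := (exp_double_tendsto ((0:ℕ) + |ν|) x hx).const_mul |ν|
    simpa using a1.add a0

/-- Coefficients of the entire part of the Bessel function of the first kind. -/
noncomputable def bc (ν : ℝ) (k : ℕ) : ℝ := 1 / (Real.Gamma (ν + (k : ℝ) + 1) * (Nat.factorial k))

/-- Entire part of the Bessel function of the first kind. -/
noncomputable def bS (ν z : ℝ) : ℝ := ∑' k : ℕ, bc ν k * z ^ k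

lemma bc_pos (ν : ℝ) (hν : -1 < ν) (k : ℕ) : 0 < bc ν k := by
  unfold bc
  have : 0 < Real.Gamma (ν + (k : ℝ) + 1) := Real.Gamma_pos_of_pos (by
    have : (0:ℝ) ≤ k := Nat.cast_nonneg k
    linarith)
  positivity

lemma bc_succ (ν : ℝ) (k : ℕ) : (k + 1) * bc ν (k + 1) = bc (ν + 1) k := by
  unfold bc
  rw [Nat.factorial_succ]
  push_cast
  rw [show ν + ((k:ℝ) + 1) + 1 = ν + 1 + k + 1 by ring]
  have : (k:ℝ) + 1 ≠ 0 := by positivity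
  have hf : (k.factorial : ℝ) ≠ 0 := by positivity
  by_cases hG : Real.Gamma (ν + 1 + k + 1) = 0
  · simp [hG]
  · field_simp

lemma bc_rec (ν : ℝ) (hν : -1 < ν) (k : ℕ) : bc ν k = (ν + k + 1) * bc (ν + 1) k := by
  unfold bc
  have hk : (0:ℝ) ≤ k := Nat.cast_nonneg k
  have h : ν + k + 1 ≠ 0 := by linarith
  rw [show ν + 1 + (k:ℝ) + 1 = (ν + k + 1) + 1 by ring, Real.Gamma_add_one h]
  have hG : Real.Gamma (ν + k + 1) ≠ 0 := (Real.Gamma_pos_of_pos (by linarith)).ne'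
  have hf : (k.factorial : ℝ) ≠ 0 := by positivity
  field_simp

lemma Gamma_lower (ν : ℝ) (hν : -1 < ν) : ∃ c > 0, ∀ k : ℕ, c ≤ Real.Gamma (ν + k + 1) := by
  refine ⟨min (Real.Gamma (ν + 1)) (Real.Gamma (ν + 2)), ?_, ?_⟩
  · exact lt_min (Real.Gamma_pos_of_pos (by linarith)) (Real.Gamma_pos_of_pos (by linarith))
  · intro k
    cases k with
    | zero => simp
    | succ k =>
      refine (min_le_right _ _).trans ?_
      induction k with
      | zero => exact (congrArg Real.Gamma (by push_cast; ring)).le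
      | succ k ih =>
        refine ih.trans ?_
        push_cast
        have hk : (0:ℝ) ≤ k := Nat.cast_nonneg k
        have e : Real.Gamma (ν + ((k:ℝ) + 1 + 1) + 1)
            = (ν + (k + 1) + 1) * Real.Gamma (ν + (k + 1) + 1) := by
          rw [← Real.Gamma_add_one (by linarith)]
          exact congrArg Real.Gamma (by ring)
        rw [e]
        have := Real.Gamma_pos_of_pos (show 0 < ν + ((k:ℝ) + 1) + 1 by linarith)
        nlinarith

lemma bS_summable (ν z : ℝ) (hν : -1 < ν) : Summable (fun k : ℕ => bc ν k * z ^ k) := by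
  obtain ⟨c, hc, h⟩ := Gamma_lower ν hν
  apply Summable.of_norm_bounded ((Real.summable_pow_div_factorial |z|).mul_left (1/c))
  intro k
  rw [norm_mul, Real.norm_of_nonneg (bc_pos ν hν k).le, norm_pow, Real.norm_eq_abs]
  unfold bc
  have := h k
  have hf : (0:ℝ) < k.factorial := by positivity
  calc _ ≤ 1 / (c * k.factorial) * |z| ^ k := by gcongr
    _ = _ := by field_simp

lemma bS_pos (ν z : ℝ) (hν : -1 < ν) (hz : 0 < z) : 0 < bS ν z := by
  have h : ∀ k, 0 < bc ν k * z ^ k := fun k => mul_pos (bc_pos ν hν k) (by positivity)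
  exact (bS_summable ν z hν).tsum_pos (fun k => (h k).le) 0 (h 0)

lemma bS_hasDerivAt (ν z : ℝ) (hν : -1 < ν) : HasDerivAt (bS ν) (bS (ν + 1) z) z := by
  have hR : (0:ℝ) < |z| + 1 := by positivity
  have h := hasDerivAt_tsum_of_isPreconnected (y₀ := 0) (y := z) (t := Metric.ball (0:ℝ) (|z| + 1))
    (g := fun (k : ℕ) z => bc ν k * z ^ k) (g' := fun (k : ℕ) z => bc ν k * (k * z ^ (k-1)))
    (u := fun k : ℕ => bc ν k * (k * (|z| + 1) ^ (k-1))) ?_ Metric.isOpen_ball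
    (convex_ball _ _).isPreconnected ?_ ?_ (Metric.mem_ball_self hR) (bS_summable ν 0 hν) (by simp)
  · refine h.congr_deriv ?_
    rw [tsum_eq_zero_add']
    · simp only [bS]
      simp only [Nat.cast_zero, zero_mul, mul_zero, zero_add]
      refine tsum_congr fun k => ?_
      rw [← bc_succ]; simp; ring
    · refine (bS_summable (ν + 1) z (by linarith)).congr fun k => ?_
      rw [← bc_succ]; simp; ring
  · rw [← summable_nat_add_iff 1]
    refine (bS_summable (ν + 1) (|z| + 1) (by linarith)).congr fun k => ?_
    rw [← bc_succ]; simp; ring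
  · intro k y _
    exact (hasDerivAt_pow k y).const_mul _
  · intro k y hy
    have hy' : |y| ≤ |z| + 1 := by simpa using (mem_ball_zero_iff.1 hy).le
    have := (bc_pos ν hν k).le
    rw [norm_mul, norm_mul, norm_pow, Real.norm_of_nonneg this, Real.norm_eq_abs, Real.norm_eq_abs,
      abs_of_nonneg (Nat.cast_nonneg k)]
    gcongr

lemma bS_rec (ν z : ℝ) (hν : -1 < ν) : bS ν z = z * bS (ν + 2) z + (ν + 1) * bS (ν + 1) z := by
  have s0 := bS_summable ν z hν
  have s1 := bS_summable (ν + 1) z (by linarith)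
  have s2 := bS_summable (ν + 2) z (by linarith)
  have e : bS ν z - (ν + 1) * bS (ν + 1) z = ∑' k : ℕ, (k * bc (ν + 1) k) * z ^ k := by
    unfold bS
    rw [← tsum_mul_left, ← s0.tsum_sub (s1.mul_left _)]
    refine tsum_congr fun k => ?_
    rw [bc_rec ν hν]; ring
  have e2 : ∑' k : ℕ, (k * bc (ν + 1) k) * z ^ k = z * bS (ν + 2) z := by
    have hk : ∀ k : ℕ, ((k + 1 : ℕ) * bc (ν + 1) (k + 1)) * z ^ (k + 1) = z * (bc (ν + 2) k * z ^ k) := by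
      intro k
      have := bc_succ (ν + 1) k
      rw [show ν + 1 + 1 = ν + 2 by ring] at this
      rw [← this]; push_cast; ring
    rw [tsum_eq_zero_add']
    · simp only [Nat.cast_zero, zero_mul, zero_add]
      unfold bS
      rw [← tsum_mul_left]
      exact tsum_congr hk
    · exact (s2.mul_left z).congr fun k => (hk k).symm
  linarith

lemma besselI_eq (ν x : ℝ) (hx : 0 < x) : besselI ν x = (x / 2) ^ ν * bS ν (x ^ 2 / 4) := by
  unfold besselI bS bc
  rw [← tsum_mul_left]
  refine tsum_congr fun k => ?_
  rw [Real.rpow_add (by positivity), show (2 * (k:ℝ)) = ((2 * k : ℕ) : ℝ) by push_cast; ring,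
    Real.rpow_natCast, pow_mul]
  ring

/-- Derivative of the Bessel function of the first kind. -/
noncomputable def bI1 (ν x : ℝ) : ℝ :=
  (x / 2) ^ ν * (ν / x * bS ν (x ^ 2 / 4) + x / 2 * bS (ν + 1) (x ^ 2 / 4))

lemma half_rpow_hasDerivAt (ν x : ℝ) (hx : 0 < x) :
    HasDerivAt (fun x : ℝ => (x / 2) ^ ν) ((x / 2) ^ ν * (ν / x)) x := by
  have h := ((hasDerivAt_id x).div_const 2).rpow_const (p := ν) (Or.inl (by simpa using hx.ne'))
  refine h.congr_deriv ?_
  simp only [id]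
  rw [Real.rpow_sub_one (by positivity)]
  field_simp

lemma bS_comp_hasDerivAt (ν x : ℝ) (hν : -1 < ν) :
    HasDerivAt (fun x : ℝ => bS ν (x ^ 2 / 4)) (x / 2 * bS (ν + 1) (x ^ 2 / 4)) x := by
  have h1 : HasDerivAt (fun x : ℝ => x ^ 2 / 4) (x / 2) x := by
    refine ((hasDerivAt_pow 2 x).div_const 4).congr_deriv ?_
    simp; ring
  have h := (bS_hasDerivAt ν (x ^ 2 / 4) hν).comp x h1
  refine h.congr_deriv (by ring)

lemma besselI_hasDerivAt (ν x : ℝ) (hν : -1 < ν) (hx : 0 < x) :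
    HasDerivAt (besselI ν) (bI1 ν x) x := by
  have h := (half_rpow_hasDerivAt ν x hx).mul (bS_comp_hasDerivAt ν x hν)
  have h' : HasDerivAt (besselI ν) _ x := h.congr_of_eventuallyEq (by
    filter_upwards [lt_mem_nhds hx] with y hy
    exact besselI_eq ν y hy)
  refine h'.congr_deriv ?_
  unfold bI1; ring

lemma bI1_hasDerivAt (ν x : ℝ) (hν : -1 < ν) (hx : 0 < x) :
    HasDerivAt (bI1 ν) (-bI1 ν x / x + (1 + ν ^ 2 / x ^ 2) * besselI ν x) x := by
  have hd : HasDerivAt (fun x : ℝ => ν / x) (-ν / x ^ 2) x := by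
    refine ((hasDerivAt_const x ν).div (hasDerivAt_id x) hx.ne').congr_deriv ?_
    simp
  have hh : HasDerivAt (fun x : ℝ => x / 2) (1 / 2) x := (hasDerivAt_id x).div_const 2
  have h := (half_rpow_hasDerivAt ν x hx).mul
    ((hd.mul (bS_comp_hasDerivAt ν x hν)).add (hh.mul (bS_comp_hasDerivAt (ν + 1) x (by linarith))))
  refine h.congr_deriv ?_
  have hr := bS_rec ν (x ^ 2 / 4) hν
  simp only [Pi.mul_apply, Pi.add_apply]
  rw [besselI_eq ν x hx, bI1, show ν + 1 + 1 = ν + 2 by ring]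
  have hs : bS (ν + 2) (x ^ 2 / 4) = (bS ν (x ^ 2 / 4) - (ν + 1) * bS (ν + 1) (x ^ 2 / 4)) / (x ^ 2 / 4) := by
    rw [eq_div_iff (by positivity)]; linarith
  rw [hs]
  field_simp
  ring

lemma bS_mono (ν z : ℝ) (hν : -1 / 2 < ν) (hz : 0 < z) : bS (ν + 2) z ≤ bS (ν + 1) z := by
  refine (bS_summable (ν + 2) z (by linarith)).tsum_le_tsum (fun k => ?_)
    (bS_summable (ν + 1) z (by linarith))
  have h1 := bc_rec (ν + 1) (by linarith) k
  rw [show ν + 1 + 1 = ν + 2 by ring] at h1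
  rw [h1]
  have := bc_pos (ν + 2) (by linarith) k
  have hk : (0:ℝ) ≤ k := Nat.cast_nonneg k
  gcongr
  nlinarith

lemma bI1_two_pos (ν : ℝ) (hν : -1 / 2 < ν) : 0 < bI1 ν 2 := by
  unfold bI1
  norm_num
  have p0 := bS_pos ν 1 (by linarith) one_pos
  have p1 := bS_pos (ν + 1) 1 (by linarith) one_pos
  have p2 := bS_mono ν 1 hν one_pos
  have hr := bS_rec ν 1 (by linarith)
  rcases le_total 0 ν with h | h
  · positivity
  · have : bS ν 1 ≤ 2 * bS (ν + 1) 1 := by nlinarith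
    nlinarith

lemma besselI_pos (ν x : ℝ) (hν : -1 < ν) (hx : 0 < x) : 0 < besselI ν x := by
  rw [besselI_eq ν x hx]
  exact mul_pos (by positivity) (bS_pos _ _ hν (by positivity))

lemma rpow_hasDerivAt_pos (ν y : ℝ) (hy : 0 < y) :
    HasDerivAt (fun y : ℝ => y ^ ν) (y ^ ν * (ν / y)) y := by
  have h := (hasDerivAt_id y).rpow_const (p := ν) (Or.inl hy.ne')
  refine h.congr_deriv ?_
  simp only [id]
  rw [Real.rpow_sub_one hy.ne']
  field_simp

lemma third_derivative (ν β σ C a b x : ℝ) (hσ : 0 < σ) (hx : 0 < x) (k i k1 i1 : ℝ → ℝ)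
    (hk : ∀ y, 0 < y → HasDerivAt k (k1 y) y)
    (hi : ∀ y, 0 < y → HasDerivAt i (i1 y) y)
    (hk1 : ∀ y, 0 < y → HasDerivAt k1 (-k1 y / y + (a + b / y ^ 2) * k y) y)
    (hi1 : ∀ y, 0 < y → HasDerivAt i1 (-i1 y / y + (a + b / y ^ 2) * i y) y)
    (hW : ∀ y, 0 < y → k1 y * i y - i1 y * k y = -C / y) :
    ∃ L0 L1 L2 : ℝ, ∀ (P Q h f : ℝ → ℝ) (s : ℝ),
      (∀ y, 0 < y → HasDerivAt P (Real.exp (β * y) * y ^ ν * i y * h y) y) →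
      (∀ y, 0 < y → HasDerivAt Q (-(Real.exp (β * y) * y ^ ν * k y * h y)) y) →
      (∀ y, 0 < y → f y = -(Real.exp (-β * y) / (σ ^ 2 * y ^ ν)) * (k y * P y + i y * Q y)) →
      HasDerivAt h s x →
      ∃ (g1 g2 : ℝ → ℝ) (d : ℝ), (∀ y, 0 < y → HasDerivAt f (g1 y) y) ∧
        (∀ y, 0 < y → HasDerivAt g1 (g2 y) y) ∧ HasDerivAt g2 d x ∧
        d = s * C / (σ ^ 2 * x) + L0 * P x + L1 * Q x + L2 * h x := by
  let E : ℝ → ℝ := fun y => Real.exp (-β * y) / (σ ^ 2 * y ^ ν)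
  let m : ℝ → ℝ := fun y => Real.exp (β * y) * y ^ ν
  let e : ℝ → ℝ := fun y => β + ν / y
  let q : ℝ → ℝ := fun y => a + b / y ^ 2
  let c0 : ℝ → ℝ := fun y => -e y ^ 2 - ν / y ^ 2 - q y
  let c1 : ℝ → ℝ := fun y => 2 * e y + 1 / y
  let cm : ℝ → ℝ := fun y => C * m y / y
  have hexp : ∀ c y : ℝ, HasDerivAt (fun y : ℝ => Real.exp (c * y)) (Real.exp (c * y) * c) y := by
    intro c y
    have : HasDerivAt (fun y : ℝ => c * y) c y := by simpa using (hasDerivAt_id y).const_mul c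
    exact this.exp
  have hE : ∀ y, 0 < y → HasDerivAt E (-(E y * e y)) y := by
    intro y hy
    have hp := (rpow_hasDerivAt_pos ν y hy).const_mul (σ ^ 2)
    have hpos : 0 < y ^ ν := Real.rpow_pos_of_pos hy ν
    refine ((hexp (-β) y).div hp (by positivity)).congr_deriv ?_
    simp only [E, e]
    field_simp
    ring
  have hm : ∀ y, 0 < y → HasDerivAt m (m y * e y) y := by
    intro y hy
    refine ((hexp β y).mul (rpow_hasDerivAt_pos ν y hy)).congr_deriv ?_
    simp only [m, e]
    ring
  have hinv : ∀ c y : ℝ, 0 < y → HasDerivAt (fun y : ℝ => c / y) (-c / y ^ 2) y := by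
    intro c y hy
    refine ((hasDerivAt_const y c).div (hasDerivAt_id y) hy.ne').congr_deriv ?_
    simp
  have he : ∀ y, 0 < y → HasDerivAt e (-ν / y ^ 2) y := fun y hy => (hinv ν y hy).const_add β
  have hEm : E x * m x = 1 / σ ^ 2 := by
    have hpos : 0 < x ^ ν := Real.rpow_pos_of_pos hx ν
    have : Real.exp (-β * x) * Real.exp (β * x) = 1 := by rw [← Real.exp_add]; simp
    simp only [E, m]
    rw [neg_mul] at this ⊢
    field_simp
    linarith
  have dsq : ∀ c : ℝ, DifferentiableAt ℝ (fun y : ℝ => c / y ^ 2) x := fun c =>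
    (differentiableAt_const c).div (differentiableAt_id.pow 2) (by simpa using hx.ne')
  have dc0 : DifferentiableAt ℝ c0 x := by
    have h1 := (he x hx).differentiableAt
    exact ((h1.pow 2).neg.sub (dsq ν)).sub ((dsq b).const_add a)
  have dc1 : DifferentiableAt ℝ c1 x :=
    ((he x hx).differentiableAt.const_mul 2).add (hinv 1 x hx).differentiableAt
  have dcm : DifferentiableAt ℝ cm x :=
    ((hm x hx).differentiableAt.const_mul C).div differentiableAt_id hx.ne'
  let l0 : ℝ := -(E x * e x) * c0 x + E x * (deriv c0 x + c1 x * q x)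
  let l1 : ℝ := -(E x * e x) * c1 x + E x * (c0 x + deriv c1 x - c1 x / x)
  let l2 : ℝ := -(E x * e x) * cm x + E x * (deriv cm x - c1 x * cm x)
  refine ⟨l0 * k x + l1 * k1 x, l0 * i x + l1 * i1 x, l2, ?_⟩
  intro P Q h f s hP hQ hf hs
  let G : ℝ → ℝ := fun y => k y * P y + i y * Q y
  let G1 : ℝ → ℝ := fun y => k1 y * P y + i1 y * Q y
  have hG : ∀ y, 0 < y → HasDerivAt G (G1 y) y := by
    intro y hy
    refine (((hk y hy).mul (hP y hy)).add ((hi y hy).mul (hQ y hy))).congr_deriv ?_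
    simp only [G1]; ring
  have hG1 : ∀ y, 0 < y → HasDerivAt G1 (-G1 y / y + q y * G y - cm y * h y) y := by
    intro y hy
    refine (((hk1 y hy).mul (hP y hy)).add ((hi1 y hy).mul (hQ y hy))).congr_deriv ?_
    have hw := hW y hy
    have e1 : k1 y * (Real.exp (β * y) * y ^ ν * i y * h y)
        + i1 y * (-(Real.exp (β * y) * y ^ ν * k y * h y)) = - cm y * h y := by
      have : -cm y * h y = Real.exp (β * y) * y ^ ν * h y * (-C / y) := by
        simp only [cm, m]; ring
      rw [this, ← hw]; ring
    simp only [G1, G, q]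
    linear_combination e1
  refine ⟨fun y => E y * (e y * G y - G1 y),
    fun y => E y * (c0 y * G y + c1 y * G1 y + cm y * h y),
    -(E x * e x) * (c0 x * G x + c1 x * G1 x + cm x * h x) +
      E x * (deriv c0 x * G x + c0 x * G1 x + (deriv c1 x * G1 x + c1 x *
        (-G1 x / x + q x * G x - cm x * h x)) + (deriv cm x * h x + cm x * s)), ?_, ?_, ?_, ?_⟩
  · intro y hy
    have h1 : HasDerivAt (fun y => -(E y) * G y) _ y := (hE y hy).neg.mul (hG y hy)
    have h2 := h1.congr_of_eventuallyEq (f₁ := f) (by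
      filter_upwards [lt_mem_nhds hy] with z hz
      exact hf z hz)
    refine h2.congr_deriv ?_
    simp only [Pi.neg_apply]
    ring
  · intro y hy
    refine ((hE y hy).mul (((he y hy).mul (hG y hy)).sub (hG1 y hy))).congr_deriv ?_
    simp only [c0, c1, Pi.mul_apply, Pi.sub_apply]
    ring
  · refine ((hE x hx).mul (((dc0.hasDerivAt.mul (hG x hx)).add
      (dc1.hasDerivAt.mul (hG1 x hx))).add (dcm.hasDerivAt.mul hs))).congr_deriv ?_
    simp only [Pi.mul_apply, Pi.add_apply]
  · have e1 : E x * (cm x * s) = s * C / (σ ^ 2 * x) := by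
      have : E x * (cm x * s) = (E x * m x) * (s * C / x) := by simp only [cm]; ring
      rw [this, hEm]; field_simp
    rw [← e1]
    simp only [l0, l1, l2, G, G1]
    ring

/-- Tent function. -/
noncomputable def tent (c ρ t : ℝ) : ℝ := max 0 (ρ - |t - c|)

lemma tent_lip (c ρ s t : ℝ) : |tent c ρ s - tent c ρ t| ≤ |s - t| := by
  unfold tent
  have h1 := abs_max_sub_max_le_abs (ρ - |s - c|) (ρ - |t - c|) 0
  rw [max_comm 0, max_comm 0]
  refine h1.trans ?_
  have h2 := abs_abs_sub_abs_le_abs_sub (t - c) (s - c)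
  calc _ = |(|t - c| - |s - c|)| := by congr 1; ring
    _ ≤ _ := h2
    _ = |s - t| := by rw [abs_sub_comm s t]; congr 1; ring

lemma tent_cont (c ρ : ℝ) : Continuous (tent c ρ) := by
  unfold tent; fun_prop

lemma tent_nonneg (c ρ t : ℝ) : 0 ≤ tent c ρ t := le_max_left _ _

lemma tent_le (c ρ t : ℝ) (hρ : 0 ≤ ρ) : tent c ρ t ≤ ρ :=
  max_le hρ (by linarith [abs_nonneg (t - c)])

lemma tent_zero (c ρ t : ℝ) (h : ρ ≤ |t - c|) : tent c ρ t = 0 :=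
  max_eq_left (by linarith)

lemma mul_cont (φ h : ℝ → ℝ) (x : ℝ) (hx : 0 < x) (hφ : ContinuousOn φ (Set.Ioi 0))
    (hh : Continuous h) (h0 : ∀ t, t ∉ Set.Icc (x / 2) (3 * x) → h t = 0) :
    Continuous (fun t => φ t * h t) := by
  rw [continuous_iff_continuousAt]
  intro t
  rcases le_or_gt t 0 with ht | ht
  · have : (fun t => φ t * h t) =ᶠ[nhds t] fun _ => 0 := by
      filter_upwards [gt_mem_nhds (show t < x / 2 by linarith)] with s hs
      rw [h0 s (fun hm => by linarith [hm.1]), mul_zero]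
    exact continuousAt_const.congr this.symm
  · exact (hφ.continuousAt (Ioi_mem_nhds ht)).mul hh.continuousAt

lemma mul_compact (φ h : ℝ → ℝ) (x : ℝ)
    (h0 : ∀ t, t ∉ Set.Icc (x / 2) (3 * x) → h t = 0) :
    HasCompactSupport (fun t => φ t * h t) := by
  apply HasCompactSupport.intro (isCompact_Icc (a := x / 2) (b := 3 * x))
  intro t ht
  rw [h0 t ht, mul_zero]

lemma mul_bound (φ : ℝ → ℝ) (x : ℝ) (hx : 0 < x) (hφ : ContinuousOn φ (Set.Ioi 0)) :
    ∃ B > 0, ∀ (h : ℝ → ℝ) (ε : ℝ) (S : Set ℝ), (∀ t, t ∉ Set.Icc (x / 2) (3 * x) → h t = 0) →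
      (∀ t, |h t| ≤ ε) → MeasurableSet S → |∫ t in S, φ t * h t| ≤ B * ε := by
  have hsub : Set.Icc (x / 2) (3 * x) ⊆ Set.Ioi 0 := fun t ht => by
    have := ht.1
    show 0 < t
    linarith
  obtain ⟨B, hB⟩ := isCompact_Icc.exists_bound_of_continuousOn (hφ.mono hsub)
  have hB' : ∀ t ∈ Set.Icc (x / 2) (3 * x), |φ t| ≤ |B| + 1 := fun t ht =>
    (hB t ht).trans (by linarith [le_abs_self B])
  refine ⟨(|B| + 1) * (5 / 2 * x), by positivity, ?_⟩
  intro h ε S h0 hε hS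
  have e1 : ∫ t in S, φ t * h t =
      ∫ t in Set.Icc (x / 2) (3 * x), S.indicator (fun t => φ t * h t) t := by
    rw [← integral_indicator hS]
    symm
    apply setIntegral_eq_integral_of_forall_compl_eq_zero
    intro t ht
    simp [Set.indicator, h0 t ht]
  rw [e1]
  have hε0 : 0 ≤ ε := (abs_nonneg _).trans (hε 0)
  have := norm_setIntegral_le_of_norm_le_const (μ := volume) (s := Set.Icc (x / 2) (3 * x))
    (f := S.indicator (fun t => φ t * h t)) (C := (|B| + 1) * ε) (by simp) (by
      intro t ht
      refine (norm_indicator_le_norm_self _ _).trans ?_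
      rw [norm_mul]
      exact mul_le_mul (hB' t ht) (hε t) (abs_nonneg _) (by positivity))
  rw [Real.norm_eq_abs] at this
  refine this.trans ?_
  rw [Real.volume_real_Icc_of_le (by linarith)]
  apply le_of_eq; ring

lemma exists_test (ψ : ℝ → ℝ) (x : ℝ) (hx : 0 < x) (hψ : ContinuousOn ψ (Set.Ioi 0))
    (hψ0 : ∀ t, 0 < t → 0 < ψ t) (ε : ℝ) (hε : 0 < ε) :
    ∃ h : ℝ → ℝ, LipschitzWith 1 h ∧ (∀ t, t ∉ Set.Icc (x / 2) (3 * x) → h t = 0) ∧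
      HasDerivAt h (1 / 2) x ∧ (∀ t, |h t| ≤ ε) ∧ ∫ t, ψ t * h t = 0 := by
  obtain ⟨B, hB, hBd⟩ := mul_bound ψ x hx hψ
  have z2 : ∀ t, t ∉ Set.Icc (x / 2) (3 * x) → tent (2 * x) (x / 2) t = 0 := by
    intro t ht
    apply tent_zero
    by_contra hc
    push Not at hc
    rw [abs_lt] at hc
    exact ht ⟨by linarith, by linarith⟩
  have c2 := mul_cont ψ _ x hx hψ (tent_cont (2 * x) (x / 2)) z2
  have s2 := mul_compact ψ _ x z2
  have N2 : 0 < ∫ t, ψ t * tent (2 * x) (x / 2) t := by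
    apply c2.integral_pos_of_hasCompactSupport_nonneg_nonzero s2 (x := 2 * x)
    · intro t
      rcases le_or_gt t 0 with ht | ht
      · simp [z2 t (fun hm => by linarith [hm.1])]
      · exact mul_nonneg (hψ0 t ht).le (tent_nonneg _ _ _)
    · have : tent (2 * x) (x / 2) (2 * x) = x / 2 := by
        unfold tent; simp; positivity
      rw [this]
      have := hψ0 (2 * x) (by linarith)
      positivity
  set N := ∫ t, ψ t * tent (2 * x) (x / 2) t with hN
  obtain ⟨δ, hδ, hδx, hδε, hδ1, hδ2⟩ : ∃ δ > 0, δ ≤ x / 3 ∧ δ ≤ ε ∧ B * δ / (2 * N) ≤ 1 / 2 ∧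
      B * δ / (2 * N) ≤ ε / x := by
    refine ⟨min (min (x / 3) ε) (min (N / B) (2 * N * ε / (x * B))), ?_, ?_, ?_, ?_, ?_⟩
    · have p1 : 0 < N / B := by positivity
      have p2 : 0 < 2 * N * ε / (x * B) := by positivity
      have p3 : 0 < x / 3 := by positivity
      exact lt_min (lt_min p3 hε) (lt_min p1 p2)
    · exact (min_le_left _ _).trans (min_le_left _ _)
    · exact (min_le_left _ _).trans (min_le_right _ _)
    · rw [div_le_iff₀ (by positivity)]
      have := (min_le_right (min (x / 3) ε) (min (N / B) (2 * N * ε / (x * B)))).trans (min_le_left _ _)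
      rw [le_div_iff₀ hB] at this
      linarith
    · have := (min_le_right (min (x / 3) ε) (min (N / B) (2 * N * ε / (x * B)))).trans (min_le_right _ _)
      rw [le_div_iff₀ (by positivity)] at this
      rw [div_le_div_iff₀ (by positivity) hx]
      linarith
  have z1 : ∀ t, t ∉ Set.Icc (x / 2) (3 * x) → tent (x + δ / 2) δ t = 0 := by
    intro t ht
    apply tent_zero
    by_contra hc
    push Not at hc
    rw [abs_lt] at hc
    exact ht ⟨by linarith, by linarith⟩
  have c1 := mul_cont ψ _ x hx hψ (tent_cont (x + δ / 2) δ) z1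
  have s1 := mul_compact ψ _ x z1
  have b1 := hBd (tent (x + δ / 2) δ) δ Set.univ z1 (fun t => by
    rw [abs_of_nonneg (tent_nonneg _ _ _)]; exact tent_le _ _ _ hδ.le) MeasurableSet.univ
  rw [setIntegral_univ] at b1
  set J := ∫ t, ψ t * tent (x + δ / 2) δ t with hJ
  set l := J / (2 * N) with hl
  have hlb : |l| ≤ B * δ / (2 * N) := by
    rw [hl, abs_div, abs_of_pos (show 0 < 2 * N by positivity)]
    gcongr
  refine ⟨fun t => 1 / 2 * tent (x + δ / 2) δ t - l * tent (2 * x) (x / 2) t, ?_, ?_, ?_, ?_, ?_⟩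
  · apply LipschitzWith.of_dist_le_mul
    intro s t
    rw [Real.dist_eq, Real.dist_eq]
    have a1 := tent_lip (x + δ / 2) δ s t
    have a2 := tent_lip (2 * x) (x / 2) s t
    calc _ = |1 / 2 * (tent (x + δ / 2) δ s - tent (x + δ / 2) δ t)
          - l * (tent (2 * x) (x / 2) s - tent (2 * x) (x / 2) t)| := by congr 1; ring
      _ ≤ |1 / 2 * (tent (x + δ / 2) δ s - tent (x + δ / 2) δ t)|
          + |l * (tent (2 * x) (x / 2) s - tent (2 * x) (x / 2) t)| := abs_sub _ _
      _ ≤ 1 / 2 * |s - t| + 1 / 2 * |s - t| := by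
        rw [abs_mul, abs_mul, abs_of_pos (show (0:ℝ) < 1 / 2 by norm_num)]
        have := hlb.trans hδ1
        gcongr
      _ = _ := by simp; ring
  · intro t ht
    simp only [z1 t ht, z2 t ht]; ring
  · have hd : HasDerivAt (fun t : ℝ => 1 / 2 * (δ / 2 + t - x)) (1 / 2) x := by
      simpa using (((hasDerivAt_id x).const_add (δ / 2)).sub_const x).const_mul (1 / 2 : ℝ)
    refine hd.congr_of_eventuallyEq ?_
    filter_upwards [lt_mem_nhds (show x - δ / 2 < x by linarith),
      gt_mem_nhds (show x < x + δ / 2 by linarith)] with t h1 h2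
    have e2 : tent (2 * x) (x / 2) t = 0 := by
      apply tent_zero
      rw [abs_of_nonpos (by linarith)]; linarith
    have e1 : tent (x + δ / 2) δ t = δ / 2 + t - x := by
      unfold tent
      rw [abs_of_nonpos (by linarith), max_eq_right (by linarith)]; ring
    rw [e1, e2]; ring
  · intro t
    have a1 := tent_le (x + δ / 2) δ t hδ.le
    have a1' := tent_nonneg (x + δ / 2) δ t
    have a2 := tent_le (2 * x) (x / 2) t (by linarith)
    have a2' := tent_nonneg (2 * x) (x / 2) t
    calc _ ≤ |1 / 2 * tent (x + δ / 2) δ t| + |l * tent (2 * x) (x / 2) t| := abs_sub _ _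
      _ ≤ 1 / 2 * ε + ε / x * (x / 2) := by
        rw [abs_mul, abs_mul, abs_of_nonneg a1', abs_of_nonneg a2',
          abs_of_pos (show (0:ℝ) < 1 / 2 by norm_num)]
        have := hlb.trans hδ2
        have := a1.trans hδε
        gcongr
      _ = ε := by field_simp; ring
  · have e : (fun t => ψ t * (1 / 2 * tent (x + δ / 2) δ t - l * tent (2 * x) (x / 2) t)) =
      fun t => 1 / 2 * (ψ t * tent (x + δ / 2) δ t) - l * (ψ t * tent (2 * x) (x / 2) t) := by
      funext t; ring
    rw [e, integral_sub ((c1.integrable_of_hasCompactSupport s1).const_mul _)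
      ((c2.integrable_of_hasCompactSupport s2).const_mul _), integral_const_mul, integral_const_mul,
      ← hJ, ← hN, hl]
    field_simp
    ring

lemma abs_comp_hasDerivAt (F : ℝ → ℝ) (D α y : ℝ) (hy : 0 < y) (hF : HasDerivAt F D (α * y)) :
    HasDerivAt (fun t => F (α * |t|)) (D * α) y := by
  have h1 : HasDerivAt (fun t : ℝ => α * t) α y := by simpa using (hasDerivAt_id y).const_mul α
  have h2 : HasDerivAt (fun t => F (α * t)) (D * α) y := hF.comp y h1
  refine h2.congr_of_eventuallyEq ?_
  filter_upwards [lt_mem_nhds hy] with t ht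
  rw [abs_of_pos ht]

lemma bessel_pair (ν α : ℝ) (hν : -1 / 2 < ν) (hα : 0 < α) :
    ∃ (k1 i1 : ℝ → ℝ) (C : ℝ), 0 < C ∧
    (∀ y, 0 < y → HasDerivAt (fun t => besselK ν (α * |t|)) (k1 y) y) ∧
    (∀ y, 0 < y → HasDerivAt (fun t => besselI ν (α * |t|)) (i1 y) y) ∧
    (∀ y, 0 < y → HasDerivAt k1 (-k1 y / y + (α ^ 2 + ν ^ 2 / y ^ 2) * besselK ν (α * |y|)) y) ∧
    (∀ y, 0 < y → HasDerivAt i1 (-i1 y / y + (α ^ 2 + ν ^ 2 / y ^ 2) * besselI ν (α * |y|)) y) ∧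
    (∀ y, 0 < y → k1 y * besselI ν (α * |y|) - i1 y * besselK ν (α * |y|) = -C / y) := by
  have hν' : -1 < ν := by linarith
  let K := besselK ν
  let I := besselI ν
  let K1 : ℝ → ℝ := fun x => -bK ν 1 x
  have dK : ∀ x, 0 < x → HasDerivAt K (K1 x) x := fun x hx => by
    simp only [K, bK_zero]; exact bK_hasDerivAt ν x hx 0
  have dI : ∀ x, 0 < x → HasDerivAt I (bI1 ν x) x := fun x hx => besselI_hasDerivAt ν x hν' hx
  have dK1 : ∀ x, 0 < x → HasDerivAt K1 (-K1 x / x + (1 + ν ^ 2 / x ^ 2) * K x) x := fun x hx => by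
    refine (bK_hasDerivAt ν x hx 1).neg.congr_deriv ?_
    have := bK_ode ν x hx
    simp only [K, K1, bK_zero]
    norm_num
    field_simp
    linarith
  have dI1 : ∀ x, 0 < x → HasDerivAt (bI1 ν) (-bI1 ν x / x + (1 + ν ^ 2 / x ^ 2) * I x) x :=
    fun x hx => bI1_hasDerivAt ν x hν' hx
  let W : ℝ → ℝ := fun x => x * (K1 x * I x - bI1 ν x * K x)
  have dW : ∀ x, 0 < x → HasDerivAt W 0 x := fun x hx => by
    refine ((hasDerivAt_id x).mul (((dK1 x hx).mul (dI x hx)).sub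
      ((dI1 x hx).mul (dK x hx)))).congr_deriv ?_
    simp only [Pi.sub_apply, Pi.mul_apply, id]
    field_simp
    ring
  have cW : ∀ x, 0 < x → W x = W 2 := fun x hx =>
    isOpen_Ioi.is_const_of_deriv_eq_zero (s := Set.Ioi (0:ℝ)) isPreconnected_Ioi
      (fun y hy => (dW y hy).differentiableAt.differentiableWithinAt)
      (fun y hy => (dW y hy).deriv) hx (show (0:ℝ) < 2 by norm_num)
  have W2 : W 2 < 0 := by
    have a1 := bK_pos ν 2 (by norm_num) 0
    have a2 := bK_pos ν 2 (by norm_num) 1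
    have a3 := besselI_pos ν 2 hν' (by norm_num)
    have a4 := bI1_two_pos ν hν
    simp only [W, K, I, K1, bK_zero]
    nlinarith [mul_pos a2 a3, mul_pos a4 a1]
  refine ⟨fun y => K1 (α * |y|) * α, fun y => bI1 ν (α * |y|) * α, -W 2, by linarith, ?_, ?_, ?_, ?_, ?_⟩
  · intro y hy
    have := abs_comp_hasDerivAt K _ α y hy (dK (α * y) (by positivity))
    simpa [abs_of_pos hy] using this
  · intro y hy
    have := abs_comp_hasDerivAt I _ α y hy (dI (α * y) (by positivity))
    simpa [abs_of_pos hy] using this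
  · intro y hy
    have := (abs_comp_hasDerivAt K1 _ α y hy (dK1 (α * y) (by positivity))).mul_const α
    refine this.congr_deriv ?_
    simp only [abs_of_pos hy, K]
    field_simp
  · intro y hy
    have := (abs_comp_hasDerivAt (bI1 ν) _ α y hy (dI1 (α * y) (by positivity))).mul_const α
    refine this.congr_deriv ?_
    simp only [abs_of_pos hy, I]
    field_simp
  · intro y hy
    have := cW (α * y) (by positivity)
    simp only [abs_of_pos hy]
    rw [eq_div_iff hy.ne', neg_neg, ← this]
    simp only [W, K, I]
    ring

theorem stein_solution_third_derivative_unbounded (r θ σ : ℝ) (hr : 0 < r) (hσ : 0 < σ) :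
    ∀ M : ℝ, 0 < M →
      ∃ (h : ℝ → ℝ) (x : ℝ) (g₁ g₂ : ℝ → ℝ) (d : ℝ),
        LipschitzWith 1 h ∧ 0 < x ∧
        (∀ᶠ y in nhds x, 0 < y → HasDerivAt (steinSolution r θ σ h) (g₁ y) y) ∧
        (∀ᶠ y in nhds x, 0 < y → HasDerivAt g₁ (g₂ y) y) ∧
        HasDerivAt g₂ d x ∧ M < |d| := by
  intro M hM
  set ν : ℝ := (r - 1) / 2 with hνdef
  set α : ℝ := Real.sqrt (θ ^ 2 + σ ^ 2) / σ ^ 2 with hαdef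
  set β : ℝ := θ / σ ^ 2 with hβdef
  have hsq : 0 < Real.sqrt (θ ^ 2 + σ ^ 2) := Real.sqrt_pos.2 (by positivity)
  have hα : 0 < α := by positivity
  have hν : -1 / 2 < ν := by rw [hνdef]; linarith
  obtain ⟨k1, i1, C, hC, hk, hi, hk1, hi1, hW⟩ := bessel_pair ν α hν hα
  let x : ℝ := C / (2 * σ ^ 2 * (M + 2))
  have hx : 0 < x := by positivity
  obtain ⟨L0, L1, L2, hL⟩ := third_derivative ν β σ C (α ^ 2) (ν ^ 2) x hσ hx
    (fun t => besselK ν (α * |t|)) (fun t => besselI ν (α * |t|)) k1 i1 hk hi hk1 hi1 hW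
  let φ : ℝ → ℝ := fun t => Real.exp (β * t) * |t| ^ ν * besselI ν (α * |t|)
  let ψ : ℝ → ℝ := fun t => Real.exp (β * t) * |t| ^ ν * besselK ν (α * |t|)
  have hpow : ContinuousOn (fun t : ℝ => Real.exp (β * t) * |t| ^ ν) (Set.Ioi 0) := by
    apply ContinuousOn.mul (by fun_prop)
    apply ContinuousOn.rpow_const (by fun_prop)
    intro t ht
    exact Or.inl (abs_pos.2 (ne_of_gt ht)).ne'
  have hφ : ContinuousOn φ (Set.Ioi 0) := hpow.mul fun t ht =>
    (hi t ht).continuousAt.continuousWithinAt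
  have hψ : ContinuousOn ψ (Set.Ioi 0) := hpow.mul fun t ht =>
    (hk t ht).continuousAt.continuousWithinAt
  have hψ0 : ∀ t, 0 < t → 0 < ψ t := by
    intro t ht
    have h1 : 0 < besselK ν (α * |t|) := by
      rw [bK_zero]; exact bK_pos ν _ (by positivity) 0
    have h2 : 0 < |t| ^ ν := Real.rpow_pos_of_pos (by positivity) _
    positivity
  obtain ⟨B1, hB1, hb1⟩ := mul_bound φ x hx hφ
  obtain ⟨B2, hB2, hb2⟩ := mul_bound ψ x hx hψ
  let T : ℝ := |L0| * B1 + |L1| * B2 + |L2| + 1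
  have hT : 0 < T := by positivity
  obtain ⟨h, hlip, h0, hd, hε, hint⟩ := exists_test ψ x hx hψ hψ0 (1 / T) (by positivity)
  have hcont : Continuous h := hlip.continuous
  have cφ := mul_cont φ h x hx hφ hcont h0
  have cψ := mul_cont ψ h x hx hψ hcont h0
  have iψ : Integrable (fun t => ψ t * h t) :=
    cψ.integrable_of_hasCompactSupport (mul_compact ψ h x h0)
  have hc : htilde r θ σ h = h := by
    have : ∫ t, h t * vgDensity r θ σ t = 0 := by
      have e : ∀ t, h t * vgDensity r θ σ t =
          ((σ * Real.sqrt Real.pi * Real.Gamma (r / 2))⁻¹ *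
            ((2 * Real.sqrt (θ ^ 2 + σ ^ 2)) ^ ν)⁻¹) * (ψ t * h t) := by
        intro t
        have e1 : θ * t / σ ^ 2 = β * t := by rw [hβdef]; ring
        have e2 : Real.sqrt (θ ^ 2 + σ ^ 2) * |t| / σ ^ 2 = α * |t| := by rw [hαdef]; ring
        simp only [vgDensity, ψ, ← hνdef]
        rw [e1, e2, Real.div_rpow (abs_nonneg t) (by positivity)]
        ring
      simp_rw [e]
      rw [integral_const_mul, hint, mul_zero]
    funext t
    simp [htilde, this]
  let P : ℝ → ℝ := fun y => ∫ t in (0:ℝ)..y, φ t * h t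
  let Q : ℝ → ℝ := fun y => ∫ t in Set.Ioi y, ψ t * h t
  have hP : ∀ y, 0 < y → HasDerivAt P (Real.exp (β * y) * y ^ ν * besselI ν (α * |y|) * h y) y := by
    intro y hy
    refine (cφ.integral_hasStrictDerivAt 0 y).hasDerivAt.congr_deriv ?_
    simp only [φ, abs_of_pos hy]
  have hQ : ∀ y, 0 < y →
      HasDerivAt Q (-(Real.exp (β * y) * y ^ ν * besselK ν (α * |y|) * h y)) y := by
    intro y hy
    have e : Q = fun y => (∫ t in Set.Ioi 0, ψ t * h t) - ∫ t in (0:ℝ)..y, ψ t * h t := by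
      funext y
      have := intervalIntegral.integral_interval_add_Ioi (a := 0) (b := y) (μ := volume)
        iψ.integrableOn iψ.integrableOn
      simp only [Q]
      linarith
    rw [e]
    refine ((cψ.integral_hasStrictDerivAt 0 y).hasDerivAt.const_sub _).congr_deriv ?_
    simp only [ψ, abs_of_pos hy]
  have hf : ∀ y, 0 < y → steinSolution r θ σ h y = -(Real.exp (-β * y) / (σ ^ 2 * y ^ ν)) *
      (besselK ν (α * |y|) * P y + besselI ν (α * |y|) * Q y) := by
    intro y hy
    unfold steinSolution
    rw [hc]
    simp only [← hνdef, ← hαdef, ← hβdef, P, Q, φ, ψ, abs_of_pos hy]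
    ring
  obtain ⟨g1, g2, d, hg1, hg2, hgd, hdeq⟩ := hL P Q h _ (1 / 2) hP hQ hf hd
  refine ⟨h, x, g1, g2, d, hlip, hx, Eventually.of_forall hg1, Eventually.of_forall hg2, hgd, ?_⟩
  have bP : |P x| ≤ B1 * (1 / T) := by
    simp only [P]
    rw [intervalIntegral.integral_of_le hx.le]
    exact hb1 h _ _ h0 hε measurableSet_Ioc
  have bQ : |Q x| ≤ B2 * (1 / T) := hb2 h _ _ h0 hε measurableSet_Ioi
  have bh : |h x| ≤ 1 / T := hε x
  have main : 1 / 2 * C / (σ ^ 2 * x) = M + 2 := by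
    simp only [x]; field_simp
  have b0 : |L0 * P x + L1 * Q x + L2 * h x| ≤ 1 := by
    calc _ ≤ |L0 * P x| + |L1 * Q x| + |L2 * h x| := abs_add_three _ _ _
      _ ≤ |L0| * (B1 * (1 / T)) + |L1| * (B2 * (1 / T)) + |L2| * (1 / T) := by
        rw [abs_mul, abs_mul, abs_mul]; gcongr
      _ = (T - 1) / T := by simp only [T]; ring
      _ ≤ 1 := by rw [div_le_one hT]; linarith
  have := (abs_le.1 b0).1
  have h3 : M + 1 ≤ d := by rw [hdeq, main]; linarith
  exact lt_of_lt_of_le (by linarith) (le_abs_self d)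
end

section
/- Let 0 < ν ≤ 1/2. Then the function x ↦ eˣ·x^ν·K_ν(x) is decreasing (antitone) on (0,∞), and eˣ·x^ν·K_ν(x) ≤ 2^{ν−1}·Γ(ν) for all x > 0. -/
open Real

open MeasureTheory

lemma bk_cosh_ge (t : ℝ) : t ^ 2 / 2 ≤ Real.cosh t := by
  have h1 : Real.cosh t = 1 + 2 * Real.sinh (t / 2) ^ 2 := by
    have := Real.cosh_two_mul (t / 2)
    rw [Real.cosh_sq] at this
    rw [show t = 2 * (t / 2) by ring, this]
    ring_nf
  have h2 : (t / 2) ^ 2 ≤ Real.sinh (t / 2) ^ 2 := by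
    rcases le_total 0 (t / 2) with h | h
    · exact pow_le_pow_left₀ h (Real.self_le_sinh_iff.2 h) 2
    · have := Real.sinh_le_self_iff.2 h
      nlinarith
  nlinarith

lemma bk_integrable (μ x : ℝ) (hx : 0 < x) :
    Integrable (fun t : ℝ => Real.exp (-x * Real.cosh t + μ * t)) := by
  have h := (integrable_cexp_quadratic (b := ((x / 2 : ℝ) : ℂ)) (by simpa using hx) (μ : ℂ) 0).norm
  refine h.mono' (by fun_prop) (Filter.Eventually.of_forall fun t => ?_)
  rw [Real.norm_eq_abs, Real.abs_exp, Complex.norm_exp]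
  apply Real.exp_le_exp.2
  have : (-((x / 2 : ℝ) : ℂ) * (t : ℂ) ^ 2 + (μ : ℂ) * t + 0).re = -(x / 2) * t ^ 2 + μ * t := by
    rw [show (-((x / 2 : ℝ) : ℂ) * (t : ℂ) ^ 2 + (μ : ℂ) * t + 0)
      = ((-(x / 2) * t ^ 2 + μ * t : ℝ) : ℂ) by push_cast; ring, Complex.ofReal_re]
  rw [this]
  nlinarith [mul_le_mul_of_nonneg_left (bk_cosh_ge t) hx.le]

lemma bk_pt (μ x t : ℝ) : Real.exp (-x * Real.cosh t) * Real.cosh (μ * t)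
    = (Real.exp (-x * Real.cosh t + μ * t) + Real.exp (-x * Real.cosh t + (-μ) * t)) / 2 := by
  rw [Real.cosh_eq (μ * t), Real.exp_add, Real.exp_add]
  ring_nf

lemma bk_integrable_cosh (μ x : ℝ) (hx : 0 < x) :
    Integrable (fun t : ℝ => Real.exp (-x * Real.cosh t) * Real.cosh (μ * t)) := by
  simp_rw [bk_pt]
  exact ((bk_integrable μ x hx).add (bk_integrable (-μ) x hx)).div_const 2

lemma bk_full (μ x : ℝ) (hx : 0 < x) :
    ∫ t : ℝ, Real.exp (-x * Real.cosh t + μ * t) = 2 * besselK μ x := by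
  have h1 : ∫ t : ℝ, Real.exp (-x * Real.cosh t) * Real.cosh (μ * t) = 2 * besselK μ x := by
    rw [besselK, ← integral_comp_abs (f := fun t => Real.exp (-x * Real.cosh t) * Real.cosh (μ * t))]
    congr 1
    ext t
    rcases abs_choice t with h | h <;> simp [h]
  have h2 : ∫ t : ℝ, Real.exp (-x * Real.cosh t + (-μ) * t)
      = ∫ t : ℝ, Real.exp (-x * Real.cosh t + μ * t) := by
    rw [← integral_neg_eq_self]
    simp
  rw [← h1]
  simp_rw [bk_pt]
  rw [integral_div, integral_add (bk_integrable μ x hx) (bk_integrable (-μ) x hx), h2]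
  ring

lemma bk_mono (μ ρ x : ℝ) (hx : 0 < x) (h : |μ| ≤ |ρ|) : besselK μ x ≤ besselK ρ x := by
  refine integral_mono (bk_integrable_cosh μ x hx).integrableOn
    (bk_integrable_cosh ρ x hx).integrableOn fun t => ?_
  apply mul_le_mul_of_nonneg_left _ (Real.exp_pos _).le
  rw [Real.cosh_le_cosh, abs_mul, abs_mul]
  exact mul_le_mul_of_nonneg_right h (abs_nonneg _)

lemma bk_nonneg (μ x : ℝ) : 0 ≤ besselK μ x :=
  integral_nonneg fun t => mul_nonneg (Real.exp_pos _).le (Real.cosh_pos _).le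

/-- integrand after translation by `log x` -/
noncomputable def bkG (μ x s : ℝ) : ℝ :=
  Real.exp (-(Real.exp s + x ^ 2 * Real.exp (-s)) / 2 + μ * s)

lemma bkG_shift (μ x t : ℝ) (hx : 0 < x) :
    bkG μ x (t + Real.log x) = x ^ μ * Real.exp (-x * Real.cosh t + μ * t) := by
  rw [bkG, Real.rpow_def_of_pos hx, ← Real.exp_add, Real.cosh_eq, neg_add t, Real.exp_add t,
    Real.exp_add (-t), Real.exp_neg (Real.log x), Real.exp_log hx]
  congr 1
  field_simp
  ring

lemma bkG_integrable (μ x : ℝ) (hx : 0 < x) : Integrable (bkG μ x) := by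
  have h : Integrable (fun t => bkG μ x (t + Real.log x)) := by
    simp_rw [bkG_shift _ _ _ hx]
    exact (bk_integrable μ x hx).const_mul _
  simpa using h.comp_add_right (-Real.log x)

lemma bkG_integral (μ x : ℝ) (hx : 0 < x) : ∫ s, bkG μ x s = 2 * x ^ μ * besselK μ x := by
  rw [← integral_add_right_eq_self _ (Real.log x)]
  simp_rw [bkG_shift _ _ _ hx]
  rw [integral_const_mul, bk_full _ _ hx]
  ring

lemma bk_gamma (ν : ℝ) (hν : 0 < ν) :
    Integrable (fun s => Real.exp (-Real.exp s / 2 + ν * s)) ∧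
    ∫ s, Real.exp (-Real.exp s / 2 + ν * s) = 2 ^ ν * Real.Gamma ν := by
  have e : ∀ s : ℝ, |Real.exp s| • ((Real.exp s) ^ (ν - 1) * Real.exp (-((1 / 2) * Real.exp s)))
      = Real.exp (-Real.exp s / 2 + ν * s) := fun s => by
    rw [Real.abs_exp, smul_eq_mul, ← Real.exp_mul, ← Real.exp_add, ← Real.exp_add]
    ring_nf
  have him : Real.exp '' Set.univ = Set.Ioi 0 := by rw [Set.image_univ, Real.range_exp]
  have hd : ∀ s ∈ (Set.univ : Set ℝ), HasDerivWithinAt Real.exp (Real.exp s) Set.univ s :=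
    fun s _ => (Real.hasDerivAt_exp s).hasDerivWithinAt
  have h2 := integral_image_eq_integral_abs_deriv_smul MeasurableSet.univ hd
    Real.exp_injective.injOn (fun u => u ^ (ν - 1) * Real.exp (-((1 / 2) * u)))
  have hi := integrableOn_image_iff_integrableOn_abs_deriv_smul MeasurableSet.univ hd
    Real.exp_injective.injOn (fun u => u ^ (ν - 1) * Real.exp (-((1 / 2) * u)))
  simp_rw [e] at h2 hi
  rw [him, Real.integral_rpow_mul_exp_neg_mul_Ioi hν (by norm_num), Measure.restrict_univ] at h2
  rw [him, integrableOn_univ] at hi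
  refine ⟨hi.1 ?_, by rw [← h2]; norm_num⟩
  have := integrableOn_rpow_mul_exp_neg_mul_rpow (p := 1) (s := ν - 1) (b := 1 / 2)
    (by linarith) one_pos (by norm_num)
  simpa using this

lemma bk_bound (ν x : ℝ) (hν : 0 < ν) (hx : 0 < x) :
    Real.exp x * x ^ ν * besselK ν x ≤ Real.exp x * (2 ^ (ν - 1) * Real.Gamma ν) := by
  have h := integral_mono (bkG_integrable ν x hx) (bk_gamma ν hν).1 (fun s => by
    apply Real.exp_le_exp.2
    have : 0 ≤ x ^ 2 * Real.exp (-s) := by positivity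
    linarith)
  rw [bkG_integral _ _ hx, (bk_gamma ν hν).2] at h
  rw [mul_assoc]
  apply mul_le_mul_of_nonneg_left _ (Real.exp_pos _).le
  rw [Real.rpow_sub_one two_ne_zero]
  linarith

lemma bk_step (ν x y : ℝ) (hν : 0 < ν) (hν2 : ν ≤ 1 / 2) (hx : 0 < x) (hxy : x ≤ y) :
    Real.exp y * y ^ ν * besselK ν y - Real.exp x * x ^ ν * besselK ν x
      ≤ (y - x) ^ 2 / (2 * y) * (Real.exp y * y ^ ν * besselK ν y) := by
  have hy : 0 < y := hx.trans_le hxy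
  have hpt : ∀ s, Real.exp y * ((1 - (y - x)) * bkG ν y s + (y ^ 2 - x ^ 2) / 2 * bkG (ν - 1) y s)
      ≤ Real.exp x * bkG ν x s := fun s => by
    have e1 : bkG (ν - 1) y s = bkG ν y s * Real.exp (-s) := by
      rw [bkG, bkG, ← Real.exp_add]; ring_nf
    have e2 : Real.exp x * bkG ν x s = Real.exp y * bkG ν y s *
        Real.exp (-(y - x) + (y ^ 2 - x ^ 2) / 2 * Real.exp (-s)) := by
      rw [bkG, bkG, ← Real.exp_add, ← Real.exp_add, ← Real.exp_add]; ring_nf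
    have h := Real.add_one_le_exp (-(y - x) + (y ^ 2 - x ^ 2) / 2 * Real.exp (-s))
    have hp : 0 ≤ Real.exp y * bkG ν y s := mul_nonneg (Real.exp_pos _).le (Real.exp_pos _).le
    rw [e1, e2]
    have := mul_le_mul_of_nonneg_left h hp
    linarith
  have h := integral_mono ((((bkG_integrable ν y hy).const_mul (1 - (y - x))).add
    ((bkG_integrable (ν - 1) y hy).const_mul ((y ^ 2 - x ^ 2) / 2))).const_mul (Real.exp y))
    ((bkG_integrable ν x hx).const_mul (Real.exp x)) hpt
  simp only [Pi.add_apply] at h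
  rw [integral_const_mul, integral_const_mul, integral_add ((bkG_integrable ν y hy).const_mul _)
    ((bkG_integrable (ν - 1) y hy).const_mul _), integral_const_mul, integral_const_mul,
    bkG_integral _ _ hx, bkG_integral _ _ hy, bkG_integral _ _ hy,
    Real.rpow_sub_one hy.ne'] at h
  have hm : besselK ν y ≤ besselK (ν - 1) y := bk_mono _ _ _ hy (by
    rw [abs_of_pos hν, abs_of_neg (by linarith)]; linarith)
  have hc : 0 ≤ Real.exp y * (y ^ ν / y) * (y ^ 2 - x ^ 2) := by
    have : 0 ≤ y ^ 2 - x ^ 2 := by nlinarith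
    positivity
  have h3 := mul_le_mul_of_nonneg_left hm hc
  have h4 : (y - x) ^ 2 / (2 * y) * (Real.exp y * y ^ ν * besselK ν y)
      = (y - x) * (Real.exp y * y ^ ν * besselK ν y)
        - Real.exp y * (y ^ ν / y) * (y ^ 2 - x ^ 2) * besselK ν y / 2 := by
    field_simp
    ring
  rw [h4]
  linarith

lemma bk_anti (ν x y : ℝ) (hν : 0 < ν) (hν2 : ν ≤ 1 / 2) (hx : 0 < x) (hxy : x ≤ y) :
    Real.exp y * y ^ ν * besselK ν y ≤ Real.exp x * x ^ ν * besselK ν x := by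
  set F : ℝ → ℝ := fun x => Real.exp x * x ^ ν * besselK ν x with hF
  set C : ℝ := Real.exp y * (2 ^ (ν - 1) * Real.Gamma ν) / (2 * x) with hC
  have hΓ := Real.Gamma_pos_of_pos hν
  have key : ∀ n : ℕ, ∀ a b : ℝ, x ≤ a → a ≤ b → b ≤ y →
      F b - F a ≤ C * (b - a) ^ 2 * (1 / 2) ^ n := by
    intro n
    induction n with
    | zero =>
      intro a b ha hab hb
      have ha0 : 0 < a := hx.trans_le ha
      have hb0 : 0 < b := ha0.trans_le hab
      have h1 : F b ≤ Real.exp y * (2 ^ (ν - 1) * Real.Gamma ν) :=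
        (bk_bound ν b hν hb0).trans
          (mul_le_mul_of_nonneg_right (Real.exp_le_exp.2 hb) (by positivity))
      calc F b - F a ≤ (b - a) ^ 2 / (2 * b) * F b := bk_step ν a b hν hν2 ha0 hab
        _ ≤ (b - a) ^ 2 / (2 * x) * (Real.exp y * (2 ^ (ν - 1) * Real.Gamma ν)) := by
          apply mul_le_mul _ h1 _ (by positivity)
          · exact div_le_div_of_nonneg_left (by positivity) (by positivity) (by linarith)
          · have := bk_nonneg ν b
            simp only [hF]; positivity
        _ = _ := by rw [hC]; ring
    | succ n ih =>
      intro a b ha hab hb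
      have h1 := ih a ((a + b) / 2) ha (by linarith) (by linarith)
      have h2 := ih ((a + b) / 2) b (by linarith) (by linarith) hb
      rw [pow_succ _ n]
      have h3 := add_le_add h1 h2
      have h4 : C * ((a + b) / 2 - a) ^ 2 * (1 / 2) ^ n + C * (b - (a + b) / 2) ^ 2 * (1 / 2) ^ n
          = C * (b - a) ^ 2 * ((1 / 2) ^ n * (1 / 2)) := by ring
      linarith
  have hlim : Filter.Tendsto (fun n : ℕ => C * (y - x) ^ 2 * (1 / 2 : ℝ) ^ n) Filter.atTop
      (nhds (C * (y - x) ^ 2 * 0)) :=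
    (tendsto_pow_atTop_nhds_zero_of_lt_one (by norm_num) (by norm_num)).const_mul _
  have := ge_of_tendsto' hlim fun n => key n x y le_rfl hxy le_rfl
  simp only [hF, mul_zero] at this
  linarith

theorem besselK_exp_decreasing_and_bounded (ν : ℝ) (hν0 : 0 < ν) (hν : ν ≤ 1 / 2) :
    AntitoneOn (fun x : ℝ => Real.exp x * x ^ ν * besselK ν x) (Set.Ioi 0) ∧
    ∀ x : ℝ, 0 < x → Real.exp x * x ^ ν * besselK ν x ≤ (2:ℝ) ^ (ν - 1) * Real.Gamma ν := by
  refine ⟨fun x hx y _ hxy => bk_anti ν x y hν0 hν hx hxy, fun x hx => ?_⟩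
  have hlim : Filter.Tendsto (fun z : ℝ => Real.exp z * ((2:ℝ) ^ (ν - 1) * Real.Gamma ν))
      (nhdsWithin 0 (Set.Ioi 0)) (nhds (Real.exp 0 * ((2:ℝ) ^ (ν - 1) * Real.Gamma ν))) :=
    ((Real.continuous_exp.mul continuous_const).tendsto 0).mono_left nhdsWithin_le_nhds
  rw [Real.exp_zero, one_mul] at hlim
  refine ge_of_tendsto hlim ?_
  filter_upwards [Ioo_mem_nhdsGT hx] with z hz
  exact (bk_anti ν z x hν0 hν hz.1 hz.2.le).trans (bk_bound ν z hν0 hz.1)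
end

section
/- For every x with 0 < x < 0.629, one has eˣ·K₀(x) < −3·log(x). -/
open Real

/-- Modified Bessel function of the second kind of order zero. -/
noncomputable def besselK0 (x : ℝ) : ℝ :=
  ∫ t in Set.Ioi (0:ℝ), Real.exp (-x * Real.cosh t)

open MeasureTheory Set Filter Topology

/-- The Gauss-Radau type majorant polynomial of `1 / √(1 + w ^ 2)`. -/
noncomputable def majP (w : ℝ) : ℝ :=
  (1) * w ^ 0
    + (-81392886371548/165858657890625) * w ^ 2
    + (2580580618494440327/8091779514241500000) * w ^ 4
    + (-66503625494694990211/389416889122872187500) * w ^ 6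
    + (110020111141534465847/1752376001052924843750) * w ^ 8
    + (-12732928360424243168/876188000526462421875) * w ^ 10
    + (924405119805046016/463864235572833046875) * w ^ 12
    + (-60928406282002432/415036421302008515625) * w ^ 14
    + (35145628715548672/7885692004738161796875) * w ^ 16

lemma one_le_majP (u w : ℝ) (hu : 1 ≤ u) (h : u ^ 2 = 1 + w ^ 2) : 1 ≤ majP w * u := by
  have hw : w ^ 2 = u ^ 2 - 1 := by linarith
  have key : majP w * u = 1 + (u - 1) * ((u - 5 / 4) * (u - 7 / 4) * (u - 5 / 2) * (u - 3)) ^ 2 *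
      ((1024/275625) * u ^ 0
      + (410108774547244832/35047520021058496875) * u ^ 1
      + (8937845429353060256/525712800315877453125) * u ^ 2
      + (115105859351846584832/7885692004738161796875) * u ^ 3
      + (21009253350259747456/2628564001579387265625) * u ^ 4
      + (22334496725017268224/7885692004738161796875) * u ^ 5
      + (4970879287915753472/7885692004738161796875) * u ^ 6
      + (70291257431097344/876188000526462421875) * u ^ 7
      + (35145628715548672/7885692004738161796875) * u ^ 8) := by
    have e : ∀ k : ℕ, w ^ (2 * k) = (u ^ 2 - 1) ^ k := fun k => by rw [pow_mul, hw]
    have e0 := e 0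
    have e1 := e 1
    have e2 := e 2
    have e3 := e 3
    have e4 := e 4
    have e5 := e 5
    have e6 := e 6
    have e7 := e 7
    have e8 := e 8
    norm_num only at e0 e1 e2 e3 e4 e5 e6 e7 e8
    unfold majP
    rw [e1, e2, e3, e4, e5, e6, e7, e8]
    ring
  rw [key]
  have : 0 ≤ u - 1 := by linarith
  have : 0 ≤ u := by linarith
  have : 0 ≤ (u - 1) * ((u - 5 / 4) * (u - 7 / 4) * (u - 5 / 2) * (u - 3)) ^ 2 *
      ((1024/275625) * u ^ 0
      + (410108774547244832/35047520021058496875) * u ^ 1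
      + (8937845429353060256/525712800315877453125) * u ^ 2
      + (115105859351846584832/7885692004738161796875) * u ^ 3
      + (21009253350259747456/2628564001579387265625) * u ^ 4
      + (22334496725017268224/7885692004738161796875) * u ^ 5
      + (4970879287915753472/7885692004738161796875) * u ^ 6
      + (70291257431097344/876188000526462421875) * u ^ 7
      + (35145628715548672/7885692004738161796875) * u ^ 8) := by positivity
  linarith

/-- Gaussian moments. -/
noncomputable def gM (k : ℕ) : ℝ := ∫ w in Ioi (0:ℝ), w ^ (2 * k) * Real.exp (-1.258 * w ^ 2)

lemma gM_int (k : ℕ) :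
    IntegrableOn (fun w : ℝ => w ^ k * Real.exp (-1.258 * w ^ 2)) (Ioi 0) := by
  have := integrableOn_rpow_mul_exp_neg_mul_sq (b := 1.258) (by norm_num) (s := (k : ℝ))
    (by have : (0:ℝ) ≤ k := Nat.cast_nonneg k
        linarith)
  simpa only [Real.rpow_natCast] using this

lemma gM_eq (k : ℕ) :
    gM k = (1.258:ℝ) ^ (-((k:ℝ) + 1 / 2)) * (1 / 2) * Real.Gamma ((k:ℝ) + 1 / 2) := by
  have := integral_rpow_mul_exp_neg_mul_rpow (p := 2) (q := ((2 * k : ℕ) : ℝ)) (b := 1.258)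
    (by norm_num) (by have : (0:ℝ) ≤ ((2 * k : ℕ) : ℝ) := Nat.cast_nonneg _
                      linarith) (by norm_num)
  simp only [Real.rpow_natCast, Real.rpow_two] at this
  unfold gM
  rw [this]
  push_cast
  congr 3 <;> ring

lemma gM_succ (k : ℕ) : gM (k + 1) = ((k:ℝ) + 1 / 2) / 1.258 * gM k := by
  rw [gM_eq, gM_eq]
  have h : ((k:ℝ) + 1 / 2) ≠ 0 := by positivity
  have h1 : (((k + 1 : ℕ)):ℝ) + 1 / 2 = ((k:ℝ) + 1 / 2) + 1 := by push_cast; ring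
  rw [h1, Real.Gamma_add_one h, neg_add, Real.rpow_add (by norm_num), Real.rpow_neg_one]
  ring

lemma gM_zero : gM 0 = √(Real.pi / 1.258) / 2 := by
  have := integral_gaussian_Ioi 1.258
  simpa [gM] using this

lemma majP_int : IntegrableOn (fun w : ℝ => majP w * Real.exp (-1.258 * w ^ 2)) (Ioi 0) ∧
    ∫ w in Ioi (0:ℝ), majP w * Real.exp (-1.258 * w ^ 2) =
    (1) * gM 0
    + (-81392886371548/165858657890625) * gM 1
    + (2580580618494440327/8091779514241500000) * gM 2
    + (-66503625494694990211/389416889122872187500) * gM 3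
    + (110020111141534465847/1752376001052924843750) * gM 4
    + (-12732928360424243168/876188000526462421875) * gM 5
    + (924405119805046016/463864235572833046875) * gM 6
    + (-60928406282002432/415036421302008515625) * gM 7
    + (35145628715548672/7885692004738161796875) * gM 8 := by
  have hi : ∀ (a : ℝ) (k : ℕ), IntegrableOn
      (fun w : ℝ => a * (w ^ k * Real.exp (-1.258 * w ^ 2))) (Ioi 0) :=
    fun a k => (gM_int k).const_mul a
  have hs : ∀ (a : ℝ) (k : ℕ), ∫ w in Ioi (0:ℝ), a * (w ^ (2 * k) * Real.exp (-1.258 * w ^ 2))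
      = a * gM k := fun a k => by
    rw [gM, integral_const_mul]
  let cf : ℕ → ℝ := fun i => match i with
    | 0 => 1
    | 1 => -81392886371548/165858657890625
    | 2 => 2580580618494440327/8091779514241500000
    | 3 => -66503625494694990211/389416889122872187500
    | 4 => 110020111141534465847/1752376001052924843750
    | 5 => -12732928360424243168/876188000526462421875
    | 6 => 924405119805046016/463864235572833046875
    | 7 => -60928406282002432/415036421302008515625
    | 8 => 35145628715548672/7885692004738161796875
    | _ => 0
  have hf : (fun w : ℝ => majP w * Real.exp (-1.258 * w ^ 2)) =
      fun w => ∑ i ∈ Finset.range 9, cf i * (w ^ (2 * i) * Real.exp (-1.258 * w ^ 2)) := by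
    funext w
    simp only [Finset.sum_range_succ, Finset.sum_range_zero, cf, majP]
    ring
  rw [hf]
  refine ⟨integrable_finsetSum _ fun i _ => hi _ _, ?_⟩
  rw [integral_finsetSum _ fun i _ => hi _ _]
  simp only [hs]
  simp only [Finset.sum_range_succ, Finset.sum_range_zero, cf]
  ring

lemma majP_bound : 2 * ∫ w in Ioi (0:ℝ), majP w * Real.exp (-1.258 * w ^ 2) < 1.39029 := by
  rw [majP_int.2]
  have hs : √(Real.pi / 1.258) ≤ 1.58029 := by
    rw [Real.sqrt_le_left (by norm_num), div_le_iff₀ (by norm_num)]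
    have := Real.pi_lt_d6
    norm_num at this ⊢
    linarith
  have h0 := gM_zero
  have h1 := gM_succ 0
  have h2 := gM_succ 1
  have h3 := gM_succ 2
  have h4 := gM_succ 3
  have h5 := gM_succ 4
  have h6 := gM_succ 5
  have h7 := gM_succ 6
  have h8 := gM_succ 7
  norm_num only [zero_add, Nat.cast_zero, Nat.cast_one, Nat.cast_ofNat] at h1 h2 h3 h4 h5 h6 h7 h8
  rw [h8, h7, h6, h5, h4, h3, h2, h1, h0]
  linarith

lemma image_sinh : (fun t : ℝ => Real.sinh (t / 2)) '' (Ioi 0) = Ioi 0 := by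
  ext y
  constructor
  · rintro ⟨t, ht, rfl⟩
    have : 0 < t / 2 := half_pos ht
    exact Real.sinh_pos_iff.2 this
  · intro hy
    refine ⟨2 * Real.arsinh y, ?_, ?_⟩
    · have := Real.arsinh_pos_iff.2 hy
      show 0 < 2 * Real.arsinh y
      linarith
    · show Real.sinh (2 * Real.arsinh y / 2) = y
      rw [mul_div_cancel_left₀ _ (two_ne_zero), Real.sinh_arsinh]

lemma f_int (x : ℝ) (hx : 0 < x) :
    IntegrableOn (fun t => Real.exp (-x * (Real.cosh t - 1))) (Ioi 0) := by
  have h := (exp_neg_integrableOn_Ioi 0 hx).mul_const (Real.exp x)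
  refine Integrable.mono' h ?_ ?_
  · exact (by fun_prop : Continuous fun t => Real.exp (-x * (Real.cosh t - 1))).aestronglyMeasurable
  · filter_upwards [ae_restrict_mem measurableSet_Ioi] with t ht
    have ht' : 0 < t := ht
    rw [Real.norm_eq_abs, abs_of_pos (Real.exp_pos _), ← Real.exp_add]
    apply Real.exp_le_exp.2
    have h1 : t ≤ Real.cosh t := (Real.self_le_sinh_iff.2 ht'.le).trans (Real.sinh_lt_cosh t).le
    nlinarith

lemma F_a : ∫ t in Ioi (0:ℝ), Real.exp (-0.629 * (Real.cosh t - 1)) < 1.39029 := by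
  refine lt_of_le_of_lt ?_ majP_bound
  have hd : ∀ t ∈ Ioi (0:ℝ), HasDerivWithinAt (fun t : ℝ => Real.sinh (t / 2))
      (Real.cosh (t / 2) * (1 / 2)) (Ioi 0) t := fun t _ =>
    (((hasDerivAt_id t).div_const 2).sinh).hasDerivWithinAt
  have hinj : InjOn (fun t : ℝ => Real.sinh (t / 2)) (Ioi 0) := by
    intro s _ t _ h
    have := Real.sinh_injective h
    linarith
  have h1 := (integrableOn_image_iff_integrableOn_abs_deriv_smul measurableSet_Ioi hd hinj
    (fun w : ℝ => majP w * Real.exp (-1.258 * w ^ 2))).1 (by rw [image_sinh]; exact majP_int.1)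
  have h2 := integral_image_eq_integral_abs_deriv_smul measurableSet_Ioi hd hinj
    (fun w : ℝ => majP w * Real.exp (-1.258 * w ^ 2))
  rw [image_sinh] at h2
  rw [h2, ← integral_const_mul]
  refine setIntegral_mono_on (f_int _ (by norm_num)) (h1.const_mul 2) measurableSet_Ioi ?_
  intro t _
  have hc := Real.cosh_pos (t / 2)
  have hsq := Real.cosh_sq (t / 2)
  have e : Real.cosh t = Real.cosh (t / 2) ^ 2 + Real.sinh (t / 2) ^ 2 := by
    rw [← Real.cosh_two_mul]; congr 1; ring
  have hm := one_le_majP (Real.cosh (t / 2)) (Real.sinh (t / 2)) (Real.one_le_cosh _)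
    (by linarith)
  have e2 : -0.629 * (Real.cosh t - 1) = -1.258 * Real.sinh (t / 2) ^ 2 := by
    rw [e, hsq]; ring
  rw [e2, abs_of_pos (by positivity), smul_eq_mul]
  have := Real.exp_pos (-1.258 * Real.sinh (t / 2) ^ 2)
  nlinarith

lemma F_shift (x a : ℝ) (hx : 0 < x) (hxa : x < a) :
    ∫ t in Ioi (0:ℝ), Real.exp (-x * (Real.cosh t - 1)) ≤
      Real.log (a / x) + ∫ t in Ioi (0:ℝ), Real.exp (-a * (Real.cosh t - 1)) := by
  have ha : 0 < a := hx.trans hxa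
  set δ := Real.log (a / x) with hδ
  have hδ0 : 0 ≤ δ := Real.log_nonneg ((one_le_div hx).2 hxa.le)
  have hi := f_int x hx
  have hi1 := hi.mono_set (Ioc_subset_Ioi_self : Ioc 0 δ ⊆ Ioi 0)
  have hi2 := hi.mono_set (Ioi_subset_Ioi hδ0 : Ioi δ ⊆ Ioi 0)
  have hmp := measurePreserving_add_right (volume : Measure ℝ) δ
  have hme := measurableEmbedding_addRight (G := ℝ) δ
  have hpre : (fun t : ℝ => t + δ) ⁻¹' (Ioi δ) = Ioi 0 := by
    ext t
    simp
  have hsh : IntegrableOn (fun t => Real.exp (-x * (Real.cosh (t + δ) - 1))) (Ioi 0) := by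
    have := (hmp.integrableOn_comp_preimage hme (s := Ioi δ)
      (f := fun t => Real.exp (-x * (Real.cosh t - 1)))).2 hi2
    rw [hpre] at this
    exact this
  have hse : ∫ t in Ioi (0:ℝ), Real.exp (-x * (Real.cosh (t + δ) - 1)) =
      ∫ t in Ioi δ, Real.exp (-x * (Real.cosh t - 1)) := by
    have := hmp.setIntegral_preimage_emb hme (fun t => Real.exp (-x * (Real.cosh t - 1))) (Ioi δ)
    rw [hpre] at this
    exact this
  rw [← Ioc_union_Ioi_eq_Ioi hδ0, setIntegral_union (Ioc_disjoint_Ioi le_rfl) measurableSet_Ioi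
    hi1 hi2, Ioc_union_Ioi_eq_Ioi hδ0, ← hse]
  refine add_le_add ?_ ?_
  · have : ∫ t in Ioc 0 δ, Real.exp (-x * (Real.cosh t - 1)) ≤ ∫ t in Ioc 0 δ, (1:ℝ) := by
      refine setIntegral_mono_on hi1 (by simp) measurableSet_Ioc ?_
      intro t _
      apply Real.exp_le_one_iff.2
      nlinarith [Real.one_le_cosh t]
    simpa [hδ0] using this
  · refine setIntegral_mono_on hsh (f_int a ha) measurableSet_Ioi ?_
    intro s hs
    apply Real.exp_le_exp.2
    have hs0 : 0 < s := hs
    have e1 : Real.exp δ = a / x := Real.exp_log (by positivity)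
    rw [Real.cosh_eq, Real.cosh_eq, neg_add, Real.exp_add, Real.exp_add, Real.exp_neg δ, e1]
    have h3 : Real.exp (-s) ≤ 1 := Real.exp_le_one_iff.2 (by linarith)
    have h4 := Real.exp_pos (-s)
    have h5 : x / a < 1 := (div_lt_one ha).2 hxa
    have h6 : 0 < x / a := by positivity
    have h7 : 0 ≤ (a - x) * (1 - (1 + x / a) * Real.exp (-s) / 2) := by
      apply mul_nonneg (by linarith)
      nlinarith
    have h8 : x * ((Real.exp s * (a / x) + Real.exp (-s) * (a / x)⁻¹) / 2 - 1) -
        a * ((Real.exp s + Real.exp (-s)) / 2 - 1) =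
        (a - x) * (1 - (1 + x / a) * Real.exp (-s) / 2) := by
      field_simp
      ring
    linarith

lemma log_bd : 1.39029 < -3 * Real.log 0.629 := by
  have h : Real.log 0.629 < -0.46343 := by
    rw [Real.log_lt_iff_lt_exp (by norm_num), Real.exp_neg, lt_inv_comm₀ (by norm_num)
      (Real.exp_pos _)]
    have := Real.exp_bound' (x := 0.46343) (by norm_num) (by norm_num) (n := 6) (by norm_num)
    refine this.trans_lt ?_
    norm_num [Finset.sum_range_succ, Nat.factorial]
  linarith

theorem besselK0_lt_neg_three_log (x : ℝ) (hx0 : 0 < x) (hx : x < 0.629) :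
    Real.exp x * besselK0 x < -3 * Real.log x := by
  have h1 : Real.exp x * besselK0 x = ∫ t in Ioi (0:ℝ), Real.exp (-x * (Real.cosh t - 1)) := by
    rw [besselK0, ← integral_const_mul]
    congr 1
    funext t
    rw [← Real.exp_add]
    congr 1
    ring
  rw [h1]
  have h2 := F_shift x 0.629 hx0 hx
  have h3 := F_a
  have h4 := log_bd
  have h5 : 0 ≤ Real.log (0.629 / x) := Real.log_nonneg ((one_le_div hx0).2 hx.le)
  rw [Real.log_div (by norm_num) hx0.ne'] at h2 h5
  linarith
end
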